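/- arXiv:2403.02146 — 3 statements merged into one kernel-verified Lean document; each statement's English description precedes it below -/
import Mathlib

section
/- (Proposition 1.) Suppose symmetric matrices (X_1,…,X_N) satisfy the coupled algebraic Riccati equations with parameters (Q_1,…,Q_N) and (R_ij), and suppose K_{j,d} C_j = R_jj⁻¹ B_jᵀ X_j for all j ∈ {1,…,N}. Fix i, and let Q_i' ∈ ℝ^{n×n} symmetric and, for j ≠ i, R_ij' ∈ ℝ^{m_j×m_j} symmetric satisfy (Q_i − Q_i') + Σ_{j≠i} (K_{j,d} C_j)ᵀ (R_ij − R_ij') (K_{j,d} C_j) = 0. Then (X_1,…,X_N) satisfies the i-th coupled algebraic Riccati equation with parameters Q_i', R_ij' (j ≠ i) and R_ii' = R_ii in place of Q_i, R_ij; in particular the modified parameters define a game for which (K_{1,d},…,K_{N,d}) remains compatible with the same stabilizing solution. -/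
open Matrix
open scoped Matrix

noncomputable section

/-- The `i`-th coupled algebraic Riccati equation, with the diagonal weights
`Rself j = R_jj` and the `i`-th row weights `Ri j = R_ij` given separately. -/
def AREi {n N : ℕ} {m : Fin N → ℕ} (A : Matrix (Fin n) (Fin n) ℝ)
    (B : ∀ j, Matrix (Fin n) (Fin (m j)) ℝ)
    (Rself : ∀ j, Matrix (Fin (m j)) (Fin (m j)) ℝ)
    (Ri : ∀ j, Matrix (Fin (m j)) (Fin (m j)) ℝ)
    (Qi : Matrix (Fin n) (Fin n) ℝ)
    (X : Fin N → Matrix (Fin n) (Fin n) ℝ) (i : Fin N) : Prop :=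
  Aᵀ * X i + X i * A
    - ∑ j ∈ Finset.univ.filter (· ≠ i), X i * B j * (Rself j)⁻¹ * (B j)ᵀ * X j
    - ∑ j ∈ Finset.univ.filter (· ≠ i), X j * B j * (Rself j)⁻¹ * (B j)ᵀ * X i
    - X i * B i * (Rself i)⁻¹ * (B i)ᵀ * X i
    + ∑ j ∈ Finset.univ.filter (· ≠ i),
        X j * B j * (Rself j)⁻¹ * Ri j * (Rself j)⁻¹ * (B j)ᵀ * X j
    + Qi = 0

/-- **Proposition 1.** If `(X₁,…,X_N)` solves the coupled AREs with parameters `(Qᵢ)`, `(Rᵢⱼ)`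
and `K_{j,d} Cⱼ = Rⱼⱼ⁻¹ Bⱼᵀ Xⱼ`, and if `Qᵢ'` and `Rᵢⱼ'` (for `j ≠ i`, keeping `Rᵢᵢ' = Rᵢᵢ`)
satisfy `(Qᵢ − Qᵢ') + Σ_{j≠i} (K_{j,d} Cⱼ)ᵀ (Rᵢⱼ − Rᵢⱼ') (K_{j,d} Cⱼ) = 0`, then the same
`(X₁,…,X_N)` satisfies the `i`-th ARE with the modified parameters. -/
theorem modified_parameters_same_solution {n N : ℕ} {m p : Fin N → ℕ}
    (A : Matrix (Fin n) (Fin n) ℝ)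
    (B : ∀ j, Matrix (Fin n) (Fin (m j)) ℝ)
    (C : ∀ j, Matrix (Fin (p j)) (Fin n) ℝ)
    (Kd : ∀ j, Matrix (Fin (m j)) (Fin (p j)) ℝ)
    (R : ∀ _i j : Fin N, Matrix (Fin (m j)) (Fin (m j)) ℝ)
    (Q : Fin N → Matrix (Fin n) (Fin n) ℝ)
    (X : Fin N → Matrix (Fin n) (Fin n) ℝ)
    (hRsymm : ∀ i j, (R i j).IsSymm)
    (hRpos : ∀ j, (R j j).PosDef)
    (hQsymm : ∀ i, (Q i).IsSymm)
    (hXsymm : ∀ j, (X j).IsSymm)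
    (hARE : ∀ i, AREi A B (fun j => R j j) (fun j => R i j) (Q i) X i)
    (hK : ∀ j, Kd j * C j = (R j j)⁻¹ * (B j)ᵀ * X j)
    (i : Fin N)
    (Qi' : Matrix (Fin n) (Fin n) ℝ) (hQi' : Qi'.IsSymm)
    (Ri' : ∀ j, Matrix (Fin (m j)) (Fin (m j)) ℝ)
    (hRi'symm : ∀ j, j ≠ i → (Ri' j).IsSymm)
    (hconstraint :
      (Q i - Qi')
        + ∑ j ∈ Finset.univ.filter (· ≠ i),
            (Kd j * C j)ᵀ * (R i j - Ri' j) * (Kd j * C j) = 0) :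
    AREi A B (fun j => R j j) Ri' Qi' X i := by
  have hterm : ∀ j, ∀ S : Matrix (Fin (m j)) (Fin (m j)) ℝ,
      (Kd j * C j)ᵀ * S * (Kd j * C j)
        = X j * B j * (R j j)⁻¹ * S * (R j j)⁻¹ * (B j)ᵀ * X j := by
    intro j S
    rw [hK j, Matrix.transpose_mul, Matrix.transpose_mul, Matrix.transpose_transpose,
      Matrix.transpose_nonsing_inv, (hRsymm j j).eq, (hXsymm j).eq]
    simp only [Matrix.mul_assoc]
  have h := hARE i
  unfold AREi at h ⊢
  simp only [← hterm] at h ⊢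
  simp only [Matrix.mul_sub, Matrix.sub_mul, Finset.sum_sub_distrib] at hconstraint
  rw [← sub_eq_zero.mpr (h.trans hconstraint.symm)]
  abel
end
end

section
/- Suppose symmetric matrices (X_1,…,X_N) satisfy the coupled algebraic Riccati equations with parameters (Q_i) and (R_ij), with K_{j,d} C_j = R_jj⁻¹ B_jᵀ X_j for all j, and set A_cl = A − Σ_{j=1}^N B_j K_{j,d} C_j. Let (X_1',…,X_N') be symmetric, (Q_i') symmetric, and (R_ij') symmetric with R_jj' positive definite, such that (R_jj')⁻¹ B_jᵀ X_j' = K_{j,d} C_j for all j, and for each i: A_clᵀ (X_i − X_i') + (X_i − X_i') A_cl + (Q_i − Q_i') + Σ_{j=1}^N (K_{j,d} C_j)ᵀ (R_ij − R_ij') (K_{j,d} C_j) = 0. Then (X_1',…,X_N') satisfies the coupled algebraic Riccati equations with parameters (Q_i') and (R_ij'). -/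
open Matrix
open scoped Matrix

noncomputable section

/-- The `i`-th coupled algebraic Riccati equation. -/
def ARE {n N : ℕ} {m : Fin N → ℕ} (A : Matrix (Fin n) (Fin n) ℝ)
    (B : ∀ i, Matrix (Fin n) (Fin (m i)) ℝ)
    (R : ∀ _i j : Fin N, Matrix (Fin (m j)) (Fin (m j)) ℝ)
    (Q : Fin N → Matrix (Fin n) (Fin n) ℝ)
    (X : Fin N → Matrix (Fin n) (Fin n) ℝ) (i : Fin N) : Prop :=
  Aᵀ * X i + X i * A
    - ∑ j ∈ Finset.univ.filter (· ≠ i), X i * B j * (R j j)⁻¹ * (B j)ᵀ * X j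
    - ∑ j ∈ Finset.univ.filter (· ≠ i), X j * B j * (R j j)⁻¹ * (B j)ᵀ * X i
    - X i * B i * (R i i)⁻¹ * (B i)ᵀ * X i
    + ∑ j ∈ Finset.univ.filter (· ≠ i),
        X j * B j * (R j j)⁻¹ * R i j * (R j j)⁻¹ * (B j)ᵀ * X j
    + Q i = 0

/-- Closed-loop (Lyapunov) form of the coupled AREs. -/
theorem ARE_iff_closed_loop {n N : ℕ} {m : Fin N → ℕ}
    (A : Matrix (Fin n) (Fin n) ℝ)
    (B : ∀ j, Matrix (Fin n) (Fin (m j)) ℝ)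
    (K : ∀ j, Matrix (Fin (m j)) (Fin n) ℝ)
    (R : ∀ _i j : Fin N, Matrix (Fin (m j)) (Fin (m j)) ℝ)
    (Q : Fin N → Matrix (Fin n) (Fin n) ℝ)
    (X : Fin N → Matrix (Fin n) (Fin n) ℝ)
    (hRsymm : ∀ i j, (R i j).IsSymm) (hRpos : ∀ j, (R j j).PosDef)
    (hXsymm : ∀ j, (X j).IsSymm)
    (hK : ∀ j, (R j j)⁻¹ * (B j)ᵀ * X j = K j) (i : Fin N) :
    ARE A B R Q X i ↔
      (A - ∑ j, B j * K j)ᵀ * X i + X i * (A - ∑ j, B j * K j) + Q i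
        + ∑ j, (K j)ᵀ * R i j * K j = 0 := by
  have hKT : ∀ j, X j * B j * (R j j)⁻¹ = (K j)ᵀ := by
    intro j
    rw [← hK j, transpose_mul, transpose_mul, transpose_transpose, transpose_nonsing_inv,
      (hRsymm j j).eq, (hXsymm j).eq, Matrix.mul_assoc]
  have hKR : (K i)ᵀ * R i i = X i * B i := by
    rw [← hKT i, Matrix.mul_assoc, nonsing_inv_mul _ (hRpos i).det_pos.ne'.isUnit,
      Matrix.mul_one]
  have e1 : ∀ j, X i * B j * (R j j)⁻¹ * (B j)ᵀ * X j = X i * (B j * K j) := by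
    intro j
    rw [← hK j]; simp only [Matrix.mul_assoc]
  have e2 : ∀ j, X j * B j * (R j j)⁻¹ * (B j)ᵀ * X i = (B j * K j)ᵀ * X i := by
    intro j
    rw [hKT j, transpose_mul]
  have e3 : ∀ j, X j * B j * (R j j)⁻¹ * R i j * (R j j)⁻¹ * (B j)ᵀ * X j
      = (K j)ᵀ * R i j * K j := by
    intro j
    rw [hKT j, ← hK j]; simp only [Matrix.mul_assoc]
  have e4 : (K i)ᵀ * R i i * K i = X i * (B i * K i) := by
    rw [hKR, Matrix.mul_assoc]
  have e5 : (B i * K i)ᵀ * X i = X i * (B i * K i) := by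
    rw [← e2 i, e1 i]
  have hs : ∀ f : Fin N → Matrix (Fin n) (Fin n) ℝ,
      ∑ j ∈ Finset.univ.filter (· ≠ i), f j = ∑ j, f j - f i := by
    intro f
    rw [Finset.filter_ne', eq_sub_iff_add_eq, Finset.sum_erase_add _ _ (Finset.mem_univ i)]
  unfold ARE
  simp only [e1, e2, e3, hs]
  rw [e4, e5, transpose_sub, Matrix.sub_mul, Matrix.mul_sub, transpose_sum,
    Matrix.sum_mul, Matrix.mul_sum]
  refine Eq.congr ?_ rfl
  abel

/-- Characterization of all alternative solutions: if `(Xᵢ')`, `(Qᵢ')`, `(Rᵢⱼ')` satisfy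
`(Rⱼⱼ')⁻¹ Bⱼᵀ Xⱼ' = K_{j,d} Cⱼ` and the difference relation
`A_clᵀ ΔXᵢ + ΔXᵢ A_cl + ΔQᵢ + Σⱼ (K_{j,d} Cⱼ)ᵀ ΔRᵢⱼ (K_{j,d} Cⱼ) = 0`, then `(Xᵢ')`
satisfies the coupled AREs with the primed parameters. -/
theorem alternative_parameters_solution {n N : ℕ} {m p : Fin N → ℕ}
    (A : Matrix (Fin n) (Fin n) ℝ)
    (B : ∀ j, Matrix (Fin n) (Fin (m j)) ℝ)
    (C : ∀ j, Matrix (Fin (p j)) (Fin n) ℝ)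
    (Kd : ∀ j, Matrix (Fin (m j)) (Fin (p j)) ℝ)
    (R R' : ∀ _i j : Fin N, Matrix (Fin (m j)) (Fin (m j)) ℝ)
    (Q Q' : Fin N → Matrix (Fin n) (Fin n) ℝ)
    (X X' : Fin N → Matrix (Fin n) (Fin n) ℝ)
    (hRsymm : ∀ i j, (R i j).IsSymm) (hRpos : ∀ j, (R j j).PosDef)
    (hQsymm : ∀ i, (Q i).IsSymm) (hXsymm : ∀ j, (X j).IsSymm)
    (hARE : ∀ i, ARE A B R Q X i)
    (hK : ∀ j, Kd j * C j = (R j j)⁻¹ * (B j)ᵀ * X j)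
    (hX'symm : ∀ j, (X' j).IsSymm)
    (hQ'symm : ∀ i, (Q' i).IsSymm)
    (hR'symm : ∀ i j, (R' i j).IsSymm) (hR'pos : ∀ j, (R' j j).PosDef)
    (hK' : ∀ j, (R' j j)⁻¹ * (B j)ᵀ * X' j = Kd j * C j)
    (hdiff : ∀ i,
      (A - ∑ j, B j * Kd j * C j)ᵀ * (X i - X' i)
        + (X i - X' i) * (A - ∑ j, B j * Kd j * C j)
        + (Q i - Q' i)
        + ∑ j, (Kd j * C j)ᵀ * (R i j - R' i j) * (Kd j * C j) = 0) :
    ∀ i, ARE A B R' Q' X' i := by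
  intro i
  have h1 := (ARE_iff_closed_loop A B (fun j => Kd j * C j) R Q X hRsymm hRpos hXsymm
    (fun j => (hK j).symm) i).1 (hARE i)
  refine (ARE_iff_closed_loop A B (fun j => Kd j * C j) R' Q' X' hR'symm hR'pos hX'symm
    hK' i).2 ?_
  have h2 := hdiff i
  simp only [Matrix.mul_assoc (B _)] at h2
  beta_reduce at h1 ⊢
  generalize A - ∑ j, B j * (Kd j * C j) = Acl at h1 h2 ⊢
  simp only [Matrix.mul_sub, Matrix.sub_mul, Finset.sum_sub_distrib] at h2
  rw [← sub_eq_zero.2 (h1.trans h2.symm)]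
  abel
end
end

section
/- (Model-free initialization identity, eq. (mfinit).) Let A ∈ ℝ^{n×n}, and for j ∈ {1,…,N} let B_j ∈ ℝ^{n×m_j}, F_j ∈ ℝ^{m_j×n}, symmetric R_jj ∈ ℝ^{m_j×m_j} positive definite, and symmetric P_j ∈ ℝ^{n×n}. Fix i and a symmetric Q̃_i ∈ ℝ^{n×n}, and suppose P_i satisfies the Lyapunov equation (A − Σ_{j≥i} B_j F_j − Σ_{j<i} B_j R_jj⁻¹ B_jᵀ P_j)ᵀ P_i + P_i (A − Σ_{j≥i} B_j F_j − Σ_{j<i} B_j R_jj⁻¹ B_jᵀ P_j) = −(Q̃_i + F_iᵀ R_ii F_i). Let x : ℝ → ℝⁿ be continuously differentiable and u_j : ℝ → ℝ^{m_j} continuous with x'(τ) = A x(τ) + Σ_{j=1}^N B_j u_j(τ). Then for all t and δ ≥ 0: x(t+δ)ᵀ P_i x(t+δ) − x(t)ᵀ P_i x(t) − 2 ∫_t^{t+δ} [ Σ_{j≥i} (u_j(τ) + F_j x(τ))ᵀ B_jᵀ P_i x(τ) + Σ_{j<i} (u_j(τ) + R_jj⁻¹ B_jᵀ P_j x(τ))ᵀ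 B_jᵀ P_i x(τ) ] dτ = −∫_t^{t+δ} x(τ)ᵀ (Q̃_i + F_iᵀ R_ii F_i) x(τ) dτ. In particular, the exploration inputs u_j drop out of the relation between P_i and the trajectory data. -/
open Matrix MeasureTheory intervalIntegral
open scoped Matrix

noncomputable section

theorem mfinit_hasDerivAt_quad {n : ℕ} (P : Matrix (Fin n) (Fin n) ℝ) (hP : P.IsSymm)
    (x : ℝ → Fin n → ℝ) (xd : Fin n → ℝ) (τ : ℝ) (hx : HasDerivAt x xd τ) :
    HasDerivAt (fun s => x s ⬝ᵥ (P *ᵥ x s)) (2 * (xd ⬝ᵥ (P *ᵥ x τ))) τ := by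
  have hc := hasDerivAt_pi.1 hx
  have h : HasDerivAt (fun s => ∑ a, x s a * ∑ b, P a b * x s b)
      (∑ a, (xd a * (∑ b, P a b * x τ b) + x τ a * ∑ b, P a b * xd b)) τ := by
    refine HasDerivAt.fun_sum fun a _ => ?_
    refine (hc a).mul ?_
    exact HasDerivAt.fun_sum fun b _ => (hc b).const_mul (P a b)
  have e : x τ ⬝ᵥ (P *ᵥ xd) = xd ⬝ᵥ (P *ᵥ x τ) := by
    rw [Matrix.dotProduct_mulVec, ← Matrix.mulVec_transpose, hP.eq, dotProduct_comm]
  have e2 : (∑ a, (xd a * (∑ b, P a b * x τ b) + x τ a * ∑ b, P a b * xd b))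
      = 2 * (xd ⬝ᵥ (P *ᵥ x τ)) := by
    rw [Finset.sum_add_distrib, two_mul]
    exact congrArg₂ (· + ·) rfl e
  rw [← e2]
  exact h

theorem mfinit_lyap {n : ℕ} (K P Q : Matrix (Fin n) (Fin n) ℝ) (hP : P.IsSymm)
    (h : Kᵀ * P + P * K = -Q) (x : Fin n → ℝ) :
    2 * ((K *ᵥ x) ⬝ᵥ (P *ᵥ x)) = -(x ⬝ᵥ (Q *ᵥ x)) := by
  have h1 : x ⬝ᵥ ((Kᵀ * P) *ᵥ x) = (K *ᵥ x) ⬝ᵥ (P *ᵥ x) := by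
    rw [← Matrix.mulVec_mulVec, Matrix.dotProduct_mulVec, Matrix.vecMul_transpose]
  have h2 : x ⬝ᵥ ((P * K) *ᵥ x) = (K *ᵥ x) ⬝ᵥ (P *ᵥ x) := by
    rw [← Matrix.mulVec_mulVec, Matrix.dotProduct_mulVec, ← Matrix.mulVec_transpose, hP.eq,
      dotProduct_comm]
  have h3 := congrArg (fun M => x ⬝ᵥ (M *ᵥ x)) h
  simp only [Matrix.add_mulVec, dotProduct_add, Matrix.neg_mulVec, dotProduct_neg] at h3
  linarith

/-- **Model-free initialization identity (eq. (mfinit)).** If `Pᵢ` solves the Lyapunov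
equation of the asynchronous initialization step, then along any trajectory
`x' = A x + Σⱼ Bⱼ uⱼ` the data-based integral relation holds; in particular the
exploration inputs `uⱼ` drop out of the relation between `Pᵢ` and the trajectory data. -/
theorem model_free_initialization_identity {n N : ℕ} {m : Fin N → ℕ}
    (A : Matrix (Fin n) (Fin n) ℝ)
    (B : ∀ j, Matrix (Fin n) (Fin (m j)) ℝ)
    (F : ∀ j, Matrix (Fin (m j)) (Fin n) ℝ)
    (R : ∀ j, Matrix (Fin (m j)) (Fin (m j)) ℝ)
    (hRsymm : ∀ j, (R j).IsSymm) (hRpos : ∀ j, (R j).PosDef)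
    (P : Fin N → Matrix (Fin n) (Fin n) ℝ) (hPsymm : ∀ j, (P j).IsSymm)
    (i : Fin N)
    (Qt : Matrix (Fin n) (Fin n) ℝ) (hQt : Qt.IsSymm)
    (hLyap :
      (A - ∑ j ∈ Finset.univ.filter (fun j => i ≤ j), B j * F j
          - ∑ j ∈ Finset.univ.filter (fun j => j < i), B j * (R j)⁻¹ * (B j)ᵀ * P j)ᵀ * P i
        + P i * (A - ∑ j ∈ Finset.univ.filter (fun j => i ≤ j), B j * F j
          - ∑ j ∈ Finset.univ.filter (fun j => j < i), B j * (R j)⁻¹ * (B j)ᵀ * P j)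
        = -(Qt + (F i)ᵀ * R i * F i))
    (x : ℝ → Fin n → ℝ) (u : ∀ j, ℝ → Fin (m j) → ℝ)
    (hx : ∀ τ, HasDerivAt x (A *ᵥ x τ + ∑ j, B j *ᵥ u j τ) τ)
    (hu : ∀ j, Continuous (u j)) :
    ∀ (t δ : ℝ), 0 ≤ δ →
      x (t + δ) ⬝ᵥ (P i *ᵥ x (t + δ)) - x t ⬝ᵥ (P i *ᵥ x t)
        - 2 * ∫ τ in t..(t + δ),
            ((∑ j ∈ Finset.univ.filter (fun j => i ≤ j),
                (u j τ + F j *ᵥ x τ) ⬝ᵥ ((B j)ᵀ *ᵥ (P i *ᵥ x τ)))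
              + ∑ j ∈ Finset.univ.filter (fun j => j < i),
                (u j τ + ((R j)⁻¹ * (B j)ᵀ * P j) *ᵥ x τ) ⬝ᵥ ((B j)ᵀ *ᵥ (P i *ᵥ x τ)))
      = -∫ τ in t..(t + δ), x τ ⬝ᵥ ((Qt + (F i)ᵀ * R i * F i) *ᵥ x τ) := by
  intro t δ _
  have hxc : Continuous x := continuous_iff_continuousAt.2 fun τ => (hx τ).continuousAt
  have hPx : Continuous fun τ => P i *ᵥ x τ := continuous_const.matrix_mulVec hxc
  set G : ℝ → ℝ := fun τ => ((∑ j ∈ Finset.univ.filter (fun j => i ≤ j),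
                (u j τ + F j *ᵥ x τ) ⬝ᵥ ((B j)ᵀ *ᵥ (P i *ᵥ x τ)))
              + ∑ j ∈ Finset.univ.filter (fun j => j < i),
                (u j τ + ((R j)⁻¹ * (B j)ᵀ * P j) *ᵥ x τ) ⬝ᵥ ((B j)ᵀ *ᵥ (P i *ᵥ x τ)))
    with hG
  set q : ℝ → ℝ := fun τ => x τ ⬝ᵥ ((Qt + (F i)ᵀ * R i * F i) *ᵥ x τ) with hq
  have hGc : Continuous G := by
    refine Continuous.add ?_ ?_
    · exact continuous_finsetSum _ fun j _ =>
        ((hu j).add (continuous_const.matrix_mulVec hxc)).dotProduct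
          (continuous_const.matrix_mulVec hPx)
    · exact continuous_finsetSum _ fun j _ =>
        ((hu j).add (continuous_const.matrix_mulVec hxc)).dotProduct
          (continuous_const.matrix_mulVec hPx)
  have hqc : Continuous q := hxc.dotProduct (continuous_const.matrix_mulVec hxc)
  have hd : ∀ τ, HasDerivAt (fun s => x s ⬝ᵥ (P i *ᵥ x s)) (2 * G τ - q τ) τ := by
    intro τ
    have h := mfinit_hasDerivAt_quad (P i) (hPsymm i) x _ τ (hx τ)
    have hl := mfinit_lyap _ (P i) _ (hPsymm i) hLyap (x τ)
    convert h using 1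
    have hsplit : (∑ j, B j *ᵥ u j τ) ⬝ᵥ (P i *ᵥ x τ)
        = ∑ j ∈ Finset.univ.filter (fun j => i ≤ j), (B j *ᵥ u j τ) ⬝ᵥ (P i *ᵥ x τ)
          + ∑ j ∈ Finset.univ.filter (fun j => j < i), (B j *ᵥ u j τ) ⬝ᵥ (P i *ᵥ x τ) := by
      rw [sum_dotProduct,
        ← Finset.sum_filter_add_sum_filter_not Finset.univ (fun j => i ≤ j)]
      simp only [not_le]
    have key : ∀ (j : Fin N) (v : Fin (m j) → ℝ),
        v ⬝ᵥ ((B j)ᵀ *ᵥ (P i *ᵥ x τ)) = (B j *ᵥ v) ⬝ᵥ (P i *ᵥ x τ) := by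
      intro j v
      rw [Matrix.dotProduct_mulVec, Matrix.vecMul_transpose]
    simp only [Matrix.sub_mulVec, sub_dotProduct, Matrix.sum_mulVec, sum_dotProduct] at hl
    rw [add_dotProduct, hsplit]
    have mm : ∀ (j : Fin N) (M : Matrix (Fin (m j)) (Fin n) ℝ),
        B j *ᵥ (M *ᵥ x τ) = (B j * M) *ᵥ x τ := fun j M => Matrix.mulVec_mulVec _ _ _
    simp only [hG, hq, key, Matrix.mulVec_add, add_dotProduct, Finset.sum_add_distrib,
      mm, ← Matrix.mul_assoc] at hl ⊢
    linarith
  have hftc := integral_eq_sub_of_hasDerivAt (a := t) (b := t + δ) (fun τ _ => hd τ)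
    (((continuous_const.mul hGc).sub hqc).intervalIntegrable _ _)
  have h2G : Continuous fun τ => 2 * G τ := continuous_const.mul hGc
  rw [intervalIntegral.integral_sub (h2G.intervalIntegrable _ _)
    (hqc.intervalIntegrable _ _), intervalIntegral.integral_const_mul] at hftc
  linarith
end
end
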